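/- For every d ∈ ℕ there exists a constant γ_d such that for every n ∈ ℕ, the number of distinct n×n binary matrices that are d-twin-ordered is at most 2^(γ_d·n). -/

import Mathlib

/- A binary matrix with `n` rows and `m` columns is modelled as `M : ℕ → ℕ → Bool`,
with the relevant entries `M x y` for `x < n`, `y < m`. Generalized submatrices are
described by a row-index predicate `P` and a column-index predicate `Q`. -/

/-- The submatrix of `M` with rows `P` and columns `Q` is horizontal:
all its columns are equal (equivalently, all its rows are constant). -/
def IsHoriz (M : ℕ → ℕ → Bool) (P Q : ℕ → Prop) : Prop :=
  ∀ x y y', P x → Q y → Q y' → M x y = M x y'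

/-- The submatrix of `M` with rows `P` and columns `Q` is vertical:
all its rows are equal (equivalently, all its columns are constant). -/
def IsVert (M : ℕ → ℕ → Bool) (P Q : ℕ → Prop) : Prop :=
  ∀ x x' y, P x → P x' → Q y → M x y = M x' y

/-- The submatrix of `M` with rows `P` and columns `Q` is constant. -/
def IsConst (M : ℕ → ℕ → Bool) (P Q : ℕ → Prop) : Prop :=
  ∀ x y x' y', P x → Q y → P x' → Q y' → M x y = M x' y'

/-- Mixed: neither horizontal nor vertical. -/
def IsMixed (M : ℕ → ℕ → Bool) (P Q : ℕ → Prop) : Prop :=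
  ¬ IsHoriz M P Q ∧ ¬ IsVert M P Q

/-- A partition of the index interval `[0,n)` into consecutive nonempty blocks is recorded
by its finite set `S` of block starts: it must contain `0` and have all elements `< n`. -/
def IsPartition (n : ℕ) (S : Finset ℕ) : Prop :=
  0 ∈ S ∧ ∀ s ∈ S, s < n

/-- `x` belongs to the block of the partition (of `[0,n)`) with starts `S`
that starts at `s`: `s ≤ x < n`, and no start of `S` lies in `(s, x]`. -/
def InBlock (S : Finset ℕ) (n s x : ℕ) : Prop :=
  x < n ∧ s ≤ x ∧ ∀ t ∈ S, t ≤ x → t ≤ s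

/-- The division of the `n × m` matrix `M` given by row-block starts `R` and
column-block starts `C` has error value at most `d`: every row block and every
column block contains at most `d` non-constant zones. -/
def ErrorValueLe (M : ℕ → ℕ → Bool) (n m : ℕ) (R C : Finset ℕ) (d : ℕ) : Prop :=
  (∀ sr ∈ R, {sc | sc ∈ C ∧ ¬ IsConst M (InBlock R n sr) (InBlock C m sc)}.ncard ≤ d) ∧
  (∀ sc ∈ C, {sr | sr ∈ R ∧ ¬ IsConst M (InBlock R n sr) (InBlock C m sc)}.ncard ≤ d)

/-- The `n × m` binary matrix `M` is `d`-twin-ordered: there is a contraction sequence,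
from the finest division to the coarsest one, each division being obtained from the
previous one by merging two consecutive row blocks or two consecutive column blocks
(i.e. deleting one block start), in which every division has error value at most `d`. -/
def TwinOrdered (n m d : ℕ) (M : ℕ → ℕ → Bool) : Prop :=
  ∃ D : ℕ → Finset ℕ × Finset ℕ,
    D 0 = (Finset.range n, Finset.range m) ∧
    D ((n - 1) + (m - 1)) = ({0}, {0}) ∧
    (∀ k, k < (n - 1) + (m - 1) →
      ((D (k+1)).1 ⊆ (D k).1 ∧ (D k).1.card = (D (k+1)).1.card + 1 ∧
        (D (k+1)).2 = (D k).2) ∨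
      ((D (k+1)).2 ⊆ (D k).2 ∧ (D k).2.card = (D (k+1)).2.card + 1 ∧
        (D (k+1)).1 = (D k).1)) ∧
    (∀ k, k ≤ (n - 1) + (m - 1) → ErrorValueLe M n m (D k).1 (D k).2 d)

/-- Full binary trees with a Boolean label at every leaf and every node. They serve both as
merge trees of index intervals (labels ignored) and as decision trees (a node labelled `true`
splits the rows, a node labelled `false` splits the columns, a leaf gives the entry). -/
inductive SplitTree : Type
  | leaf (b : Bool) : SplitTree
  | node (b : Bool) (l r : SplitTree) : SplitTree

namespace SplitTree

/-- The number of inner nodes. -/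
def numNodes : SplitTree → ℕ
  | leaf _ => 0
  | node _ l r => l.numNodes + r.numNodes + 1

/-- The number of leaves. -/
def numLeaves : SplitTree → ℕ
  | leaf _ => 1
  | node _ l r => l.numLeaves + r.numLeaves

/-- A prefix code for labelled trees. -/
def encode : SplitTree → List Bool
  | leaf b => [false, b]
  | node b l r => true :: b :: (l.encode ++ r.encode)

/-- The tree with all labels negated at inner nodes. -/
def flip : SplitTree → SplitTree
  | leaf b => leaf b
  | node b l r => node (!b) l.flip r.flip

/-- The entry at `(x, y)` described by a decision tree, on the zone whose rows start at `s` and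
are merged along the tree `a`, and whose columns start at `t` and are merged along `c`. -/
def eval : SplitTree → SplitTree → SplitTree → ℕ → ℕ → ℕ → ℕ → Bool
  | leaf b, _, _, _, _, _, _ => b
  | node true l r, node _ a₁ a₂, c, s, t, x, y =>
      if x < s + a₁.numLeaves then l.eval a₁ c s t x y
      else r.eval a₂ c (s + a₁.numLeaves) t x y
  | node false l r, a, node _ c₁ c₂, s, t, x, y =>
      if y < t + c₁.numLeaves then l.eval a c₁ s t x y
      else r.eval a c₂ s (t + c₁.numLeaves) x y
  | node true _ _, leaf _, _, _, _, _, _ => false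
  | node false _ _, _, leaf _, _, _, _, _ => false

theorem numLeaves_eq (t : SplitTree) : t.numLeaves = t.numNodes + 1 := by
  induction t with
  | leaf b => rfl
  | node b l r hl hr => simp only [numLeaves, numNodes]; omega

theorem numLeaves_pos (t : SplitTree) : 0 < t.numLeaves := by
  rw [numLeaves_eq]; omega

theorem length_encode (t : SplitTree) : t.encode.length = 4 * t.numNodes + 2 := by
  induction t with
  | leaf b => rfl
  | node b l r hl hr =>
    simp only [encode, numNodes, List.length_cons, List.length_append]; omega

theorem encode_append_inj {t t' : SplitTree} {u u' : List Bool}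
    (h : t.encode ++ u = t'.encode ++ u') : t = t' ∧ u = u' := by
  induction t generalizing t' u u' with
  | leaf b => cases t' <;> simp_all [encode]
  | node b l r hl hr =>
    cases t' with
    | leaf b' => simp [encode] at h
    | node b' l' r' =>
      simp only [encode, List.cons_append, List.cons.injEq, true_and, List.append_assoc] at h
      obtain ⟨rfl, hlr⟩ := h
      obtain ⟨rfl, hr'⟩ := hl hlr
      obtain ⟨rfl, hu⟩ := hr hr'
      exact ⟨rfl, hu⟩

theorem numNodes_flip (t : SplitTree) : t.flip.numNodes = t.numNodes := by
  induction t with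
  | leaf b => rfl
  | node b l r hl hr => simp only [flip, numNodes, hl, hr]

theorem eval_flip (t a c : SplitTree) (s s' x y : ℕ) :
    t.flip.eval c a s' s y x = t.eval a c s s' x y := by
  induction t generalizing a c s s' with
  | leaf b => simp [flip, eval]
  | node b l r hl hr => cases b <;> cases a <;> cases c <;> simp [flip, eval, hl, hr]

end SplitTree

open SplitTree

/-- `a s` has as many leaves as the block of the partition `R` of `[0, n)` starting at `s`
has elements, for every `s ∈ R`. -/
def IsBlockTree (n : ℕ) (R : Finset ℕ) (a : ℕ → SplitTree) : Prop :=
  ∀ s ∈ R, ∀ x, InBlock R n s x ↔ s ≤ x ∧ x < s + (a s).numLeaves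

/-- The zones of the division `(R, C)` of `M` can be described by merge trees for the blocks and
decision trees for the zones with at most `N` inner nodes of decision trees in total. -/
def HasSplitTrees (M : ℕ → ℕ → Bool) (n m : ℕ) (R C : Finset ℕ) (N : ℕ) : Prop :=
  ∃ (a c : ℕ → SplitTree) (t : ℕ → ℕ → SplitTree),
    IsBlockTree n R a ∧ IsBlockTree m C c ∧
    (∀ s ∈ R, ∀ s' ∈ C, ∀ x y, InBlock R n s x → InBlock C m s' y →
      (t s s').eval (a s) (c s') s s' x y = M x y) ∧
    ∑ s ∈ R, ∑ s' ∈ C, (t s s').numNodes ≤ N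

theorem IsBlockTree.inBlock_self {n : ℕ} {R : Finset ℕ} {a : ℕ → SplitTree}
    (h : IsBlockTree n R a) {s : ℕ} (hs : s ∈ R) : InBlock R n s s :=
  (h s hs s).2 ⟨le_rfl, Nat.lt_add_of_pos_right (numLeaves_pos _)⟩

theorem isBlockTree_range (n : ℕ) : IsBlockTree n (Finset.range n) fun _ => leaf false := by
  intro s hs x
  rw [Finset.mem_range] at hs
  simp only [InBlock, Finset.mem_range, numLeaves]
  constructor
  · rintro ⟨hx, hsx, h⟩
    exact ⟨hsx, Nat.lt_succ_of_le (h x hx le_rfl)⟩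
  · rintro ⟨hsx, hx⟩
    exact ⟨by omega, hsx, fun t _ ht => by omega⟩

theorem hasSplitTrees_range (M : ℕ → ℕ → Bool) (n m : ℕ) :
    HasSplitTrees M n m (Finset.range n) (Finset.range m) 0 := by
  refine ⟨_, _, fun s s' => leaf (M s s'), isBlockTree_range n, isBlockTree_range m, ?_, ?_⟩
  · intro s hs s' hs' x y hx hy
    rw [isBlockTree_range n s hs] at hx
    rw [isBlockTree_range m s' hs'] at hy
    simp only [numLeaves] at hx hy
    obtain rfl : s = x := by omega
    obtain rfl : s' = y := by omega
    rfl
  · simp [numNodes]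

theorem HasSplitTrees.transpose {M : ℕ → ℕ → Bool} {n m : ℕ} {R C : Finset ℕ} {N : ℕ}
    (h : HasSplitTrees M n m R C N) : HasSplitTrees (fun x y => M y x) m n C R N := by
  obtain ⟨a, c, t, ha, hc, ht, hN⟩ := h
  refine ⟨c, a, fun s' s => (t s s').flip, hc, ha, ?_, ?_⟩
  · intro s' hs' s hs y x hy hx
    rw [eval_flip]
    exact ht s hs s' hs' x y hx hy
  · rw [Finset.sum_comm]
    simpa only [numNodes_flip] using hN

/-- Merging the block starting at `p` into the preceding block, which starts at `q`. -/
theorem IsBlockTree.merge {n : ℕ} {R : Finset ℕ} {a : ℕ → SplitTree} {p q : ℕ}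
    (hp : p ∉ R) (hq : q ∈ R) (hqp : q < p) (hmax : ∀ s ∈ R, s < p → s ≤ q)
    (h : IsBlockTree n (insert p R) a) :
    q + (a q).numLeaves = p ∧
      (∀ s ∈ R, s ≠ q → ∀ x, InBlock R n s x ↔ InBlock (insert p R) n s x) ∧
      IsBlockTree n R (Function.update a q (node true (a q) (a p))) := by
  have hpn : p < n := (h.inBlock_self (Finset.mem_insert_self p R)).1
  have hqI : q ∈ insert p R := Finset.mem_insert_of_mem hq
  have hlen : q + (a q).numLeaves = p := by
    have h₁ := (h q hqI (p - 1)).1 ⟨by omega, by omega, fun t ht htp => by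
      rcases Finset.mem_insert.1 ht with rfl | ht
      · omega
      · exact hmax t ht (by omega)⟩
    have h₂ : ¬ p < q + (a q).numLeaves := fun hlt => by
      have := ((h q hqI p).2 ⟨hqp.le, hlt⟩).2.2 p (Finset.mem_insert_self p R) le_rfl
      omega
    omega
  have hother : ∀ s ∈ R, s ≠ q → ∀ x, InBlock R n s x ↔ InBlock (insert p R) n s x := by
    intro s hs hsq x
    constructor
    · rintro ⟨hx, hsx, hb⟩
      refine ⟨hx, hsx, fun t ht htx => ?_⟩
      rcases Finset.mem_insert.1 ht with rfl | ht
      · by_contra hlt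
        have h₁ := hmax s hs (by omega)
        have h₂ := hb q hq (by omega)
        omega
      · exact hb t ht htx
    · rintro ⟨hx, hsx, hb⟩
      exact ⟨hx, hsx, fun t ht => hb t (Finset.mem_insert_of_mem ht)⟩
  refine ⟨hlen, hother, fun s hs x => ?_⟩
  by_cases hsq : s = q
  · subst hsq
    simp only [Function.update_self, numLeaves]
    have h₁ := h s hqI x
    have h₂ := h p (Finset.mem_insert_self p R) x
    constructor
    · rintro ⟨hx, hsx, hb⟩
      refine ⟨hsx, ?_⟩
      by_cases hpx : p ≤ x
      · have := (h₂.1 ⟨hx, hpx, fun t ht htx => by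
          rcases Finset.mem_insert.1 ht with rfl | ht
          · exact le_rfl
          · exact (hb t ht htx).trans hqp.le⟩).2
        omega
      · omega
    · rintro ⟨hsx, hx⟩
      by_cases hpx : p ≤ x
      · obtain ⟨hxn, -, hb⟩ := h₂.2 ⟨hpx, by omega⟩
        refine ⟨hxn, hsx, fun t ht htx => hmax t ht ?_⟩
        have h₃ := hb t (Finset.mem_insert_of_mem ht) htx
        exact lt_of_le_of_ne h₃ fun he => hp (he ▸ ht)
      · obtain ⟨hxn, -, hb⟩ := h₁.2 ⟨hsx, by omega⟩
        exact ⟨hxn, hsx, fun t ht => hb t (Finset.mem_insert_of_mem ht)⟩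
  · rw [Function.update_of_ne hsq, hother s hs hsq]
    exact h s (Finset.mem_insert_of_mem hs) x

/-- A contraction of rows creates at most `d` new inner nodes of decision trees. -/
theorem HasSplitTrees.contract_rows {M : ℕ → ℕ → Bool} {n m : ℕ} {R R' C : Finset ℕ} {N d : ℕ}
    (h : HasSplitTrees M n m R C N) (h₀ : 0 ∈ R') (hsub : R' ⊆ R) (hcard : R.card = R'.card + 1)
    (hd : ∀ s ∈ R', {s' | s' ∈ C ∧ ¬ IsConst M (InBlock R' n s) (InBlock C m s')}.ncard ≤ d) :
    HasSplitTrees M n m R' C (N + d) := by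
  classical
  obtain ⟨a, c, t, ha, hc, ht, hN⟩ := h
  obtain ⟨p, hp, rfl⟩ : ∃ p, p ∉ R' ∧ insert p R' = R := by
    obtain ⟨p, hp⟩ := Finset.card_eq_one.1
      (show (R \ R').card = 1 by rw [Finset.card_sdiff_of_subset hsub]; omega)
    have hpm : p ∈ R \ R' := by rw [hp]; exact Finset.mem_singleton_self p
    refine ⟨p, (Finset.mem_sdiff.1 hpm).2, ?_⟩
    rw [Finset.insert_eq, ← hp, Finset.sdiff_union_of_subset hsub]
  have hp₀ : 0 < p := Nat.pos_of_ne_zero fun he => hp (he ▸ h₀)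
  obtain ⟨q, hqm, hqmax⟩ := Finset.exists_max_image (R'.filter (· < p)) id
    ⟨0, Finset.mem_filter.2 ⟨h₀, hp₀⟩⟩
  obtain ⟨hq, hqp⟩ := Finset.mem_filter.1 hqm
  have hmax : ∀ s ∈ R', s < p → s ≤ q := fun s hs hsp =>
    hqmax s (Finset.mem_filter.2 ⟨hs, hsp⟩)
  obtain ⟨hlen, hother, hblock⟩ := ha.merge hp hq hqp hmax
  have hpI : p ∈ insert p R' := Finset.mem_insert_self p R'
  have hqI : q ∈ insert p R' := Finset.mem_insert_of_mem hq
  set u : ℕ → SplitTree := fun s' =>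
    if IsConst M (InBlock R' n q) (InBlock C m s') then leaf (M q s')
    else node true (t q s') (t p s') with hu
  refine ⟨_, c, Function.update t q u, hblock, hc, ?_, ?_⟩
  · intro s hs s' hs' x y hx hy
    by_cases hsq : s = q
    · subst hsq
      simp only [Function.update_self, hu]
      split_ifs with hconst
      · exact hconst _ _ _ _ (hblock.inBlock_self hs) (hc.inBlock_self hs') hx hy
      · simp only [eval, hlen]
        have hx' := (hblock s hs x).1 hx
        simp only [Function.update_self, numLeaves] at hx'
        split_ifs with hxp
        · exact ht s hqI s' hs' x y ((ha s hqI x).2 ⟨hx'.1, by omega⟩) hy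
        · exact ht p hpI s' hs' x y ((ha p hpI x).2 ⟨by omega, by omega⟩) hy
    · simp only [Function.update_of_ne hsq]
      exact ht s (Finset.mem_insert_of_mem hs) s' hs' x y ((hother s hs hsq x).1 hx) hy
  · have hcount : (C.filter fun s' => ¬ IsConst M (InBlock R' n q) (InBlock C m s')).card ≤ d := by
      rw [← Set.ncard_coe_finset, Finset.coe_filter]
      exact hd q hq
    have hrow : ∑ s' ∈ C, (u s').numNodes ≤
        ∑ s' ∈ C, (t q s').numNodes + ∑ s' ∈ C, (t p s').numNodes + d := by
      refine le_trans ?_ (Nat.add_le_add_left hcount _)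
      rw [Finset.card_filter, ← Finset.sum_add_distrib, ← Finset.sum_add_distrib]
      refine Finset.sum_le_sum fun s' _ => ?_
      by_cases hconst : IsConst M (InBlock R' n q) (InBlock C m s') <;>
        simp [hu, hconst, numNodes]
    have hrest : ∑ s ∈ R'.erase q, ∑ s' ∈ C, (Function.update t q u s s').numNodes =
        ∑ s ∈ R'.erase q, ∑ s' ∈ C, (t s s').numNodes :=
      Finset.sum_congr rfl fun s hs => by rw [Function.update_of_ne (Finset.ne_of_mem_erase hs)]
    rw [Finset.sum_insert hp, ← Finset.add_sum_erase _ _ hq] at hN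
    rw [← Finset.add_sum_erase _ _ hq, hrest, Function.update_self]
    omega

theorem isConst_transpose {M : ℕ → ℕ → Bool} {P Q : ℕ → Prop} :
    IsConst (fun x y => M y x) Q P ↔ IsConst M P Q :=
  ⟨fun h x y x' y' hx hy hx' hy' => h y x y' x' hy hx hy' hx',
    fun h y x y' x' hy hx hy' hx' => h x y x' y' hx hy hx' hy'⟩

/-- A contraction of columns creates at most `d` new inner nodes of decision trees. -/
theorem HasSplitTrees.contract_cols {M : ℕ → ℕ → Bool} {n m : ℕ} {R C C' : Finset ℕ} {N d : ℕ}
    (h : HasSplitTrees M n m R C N) (h₀ : 0 ∈ C') (hsub : C' ⊆ C) (hcard : C.card = C'.card + 1)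
    (hd : ∀ s' ∈ C', {s | s ∈ R ∧ ¬ IsConst M (InBlock R n s) (InBlock C' m s')}.ncard ≤ d) :
    HasSplitTrees M n m R C' (N + d) :=
  (h.transpose.contract_rows h₀ hsub hcard (by simpa only [isConst_transpose] using hd)).transpose

theorem TwinOrdered.hasSplitTrees {M : ℕ → ℕ → Bool} {n m d : ℕ} (h : TwinOrdered n m d M) :
    HasSplitTrees M n m {0} {0} (d * ((n - 1) + (m - 1))) := by
  obtain ⟨D, hD₀, hDK, hstep, herr⟩ := h
  set K := (n - 1) + (m - 1)
  have hzero : ∀ k ≤ K, 0 ∈ (D k).1 ∧ 0 ∈ (D k).2 := by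
    intro k hk
    induction hk using Nat.decreasingInduction with
    | of_succ k hk ih =>
      rcases hstep k hk with ⟨hs, -, he⟩ | ⟨hs, -, he⟩
      · exact ⟨hs ih.1, he ▸ ih.2⟩
      · exact ⟨he ▸ ih.1, hs ih.2⟩
    | self => simp [hDK]
  have key : ∀ k ≤ K, HasSplitTrees M n m (D k).1 (D k).2 (d * k) := by
    intro k
    induction k with
    | zero =>
      intro _
      rw [hD₀]
      exact hasSplitTrees_range M n m
    | succ k ih =>
      intro hk
      have h₀ := hzero (k + 1) hk
      have he := herr (k + 1) hk
      have ih := ih (by omega)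
      rw [Nat.mul_succ]
      rcases hstep k hk with ⟨hs, hc, heq⟩ | ⟨hs, hc, heq⟩
      · rw [← heq] at ih
        exact ih.contract_rows h₀.1 hs hc he.1
      · rw [← heq] at ih
        exact ih.contract_cols h₀.2 hs hc he.2
  simpa only [hDK] using key K le_rfl

/-- The `n × n` matrix described by a row tree, a column tree and a decision tree. -/
def matrixOfTrees (n : ℕ) (w : SplitTree × SplitTree × SplitTree) (x y : ℕ) : Bool :=
  if x < n ∧ y < n then w.2.2.eval w.1 w.2.1 0 0 x y else false

/-- The code of a triple of trees. -/
def encodeTrees (w : SplitTree × SplitTree × SplitTree) : List Bool :=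
  w.1.encode ++ (w.2.1.encode ++ w.2.2.encode)

theorem encodeTrees_append_inj {w w' : SplitTree × SplitTree × SplitTree} {u u' : List Bool}
    (h : encodeTrees w ++ u = encodeTrees w' ++ u') : w = w' := by
  obtain ⟨a, c, t⟩ := w
  obtain ⟨a', c', t'⟩ := w'
  simp only [encodeTrees, List.append_assoc] at h
  obtain ⟨rfl, h₁⟩ := encode_append_inj h
  obtain ⟨rfl, h₂⟩ := encode_append_inj h₁
  obtain ⟨rfl, -⟩ := encode_append_inj h₂
  rfl

theorem finite_and_ncard_encodeTrees_le (L : ℕ) :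
    {w | (encodeTrees w).length ≤ L}.Finite ∧ {w | (encodeTrees w).length ≤ L}.ncard ≤ 2 ^ L := by
  let f : {w | (encodeTrees w).length ≤ L} → List.Vector Bool L := fun w =>
    ⟨encodeTrees w.1 ++ List.replicate (L - (encodeTrees w.1).length) false, by
      have := w.2
      simp only [Set.mem_ofPred_eq] at this
      simp only [List.length_append, List.length_replicate]
      omega⟩
  have hf : Function.Injective f := fun w w' h =>
    Subtype.ext (encodeTrees_append_inj (congrArg Subtype.val h))
  refine ⟨Set.finite_coe_iff.1 (Finite.of_injective f hf), ?_⟩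
  have := Nat.card_le_card_of_injective f hf
  rw [Nat.card_eq_fintype_card (α := List.Vector Bool L), card_vector, Fintype.card_bool] at this
  exact this

theorem TwinOrdered.exists_matrixOfTrees_eq {M : ℕ → ℕ → Bool} {n d : ℕ}
    (hM : ∀ x y, n ≤ x ∨ n ≤ y → M x y = false) (h : TwinOrdered n n d M) :
    ∃ w, (encodeTrees w).length ≤ (8 * d + 8) * n ∧ matrixOfTrees n w = M := by
  obtain ⟨a, c, t, ha, hc, ht, hN⟩ := h.hasSplitTrees
  have hin : ∀ x, InBlock {0} n 0 x ↔ x < n := fun x => by simp [InBlock]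
  have hleaves : ∀ b : ℕ → SplitTree, IsBlockTree n {0} b → (b 0).numLeaves = n := by
    intro b hb
    have hb := fun x => (hin x).symm.trans (hb 0 (Finset.mem_singleton_self 0) x)
    have h₁ := hb n
    have h₂ := hb (b 0).numLeaves
    omega
  refine ⟨(a 0, c 0, t 0 0), ?_, ?_⟩
  · have h₁ := hleaves a ha
    have h₂ := hleaves c hc
    rw [numLeaves_eq] at h₁ h₂
    simp only [Finset.sum_singleton] at hN
    simp only [encodeTrees, List.length_append, length_encode]
    obtain ⟨k, rfl⟩ : ∃ k, n = k + 1 := ⟨n - 1, by omega⟩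
    simp only [Nat.add_sub_cancel] at hN
    nlinarith
  · funext x y
    simp only [matrixOfTrees]
    split_ifs with hxy
    · exact ht 0 (Finset.mem_singleton_self 0) 0 (Finset.mem_singleton_self 0) x y
        ((hin x).2 hxy.1) ((hin y).2 hxy.2)
    · exact (hM x y (by omega)).symm

/-- For every `d` there is a constant `γ` such that for every `n`, the number of distinct
`n × n` binary matrices that are `d`-twin-ordered is at most `2 ^ (γ * n)`. Matrices are
normalized to be `false` outside the index range `[0, n)²` so that distinct elements of
the set correspond exactly to distinct `n × n` binary matrices. -/
theorem count_twinOrdered_matrices (d : ℕ) :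
    ∃ γ : ℕ, ∀ n : ℕ,
      {M : ℕ → ℕ → Bool |
        (∀ x y, n ≤ x ∨ n ≤ y → M x y = false) ∧ TwinOrdered n n d M}.ncard ≤
        2 ^ (γ * n) := by
  refine ⟨8 * d + 8, fun n => ?_⟩
  obtain ⟨hfin, hcard⟩ := finite_and_ncard_encodeTrees_le ((8 * d + 8) * n)
  calc
    _ ≤ (matrixOfTrees n '' {w | (encodeTrees w).length ≤ (8 * d + 8) * n}).ncard :=
      Set.ncard_le_ncard (fun M hM => hM.2.exists_matrixOfTrees_eq hM.1) (hfin.image _)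
    _ ≤ _ := (Set.ncard_image_le hfin).trans hcard
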